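/- There are no positive integers n1, n2, n3 and a such that α^{n1} + α^{n2} + α^{n3} = 2^a · √5. -/

import Mathlib

theorem alpha_pow_form (n : ℕ) : ∃ p q : ℚ, 0 < p ∧ 0 ≤ q ∧
    ((1 + Real.sqrt 5) / 2) ^ n = (p : ℝ) + q * Real.sqrt 5 := by
  induction n with
  | zero => exact ⟨1, 0, by norm_num, le_refl _, by simp⟩
  | succ k ih =>
    obtain ⟨p, q, hp, hq, h⟩ := ih
    refine ⟨(p + 5 * q) / 2, (p + q) / 2, by positivity, by positivity, ?_⟩
    have h5 : Real.sqrt 5 * Real.sqrt 5 = 5 := Real.mul_self_sqrt (by norm_num)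
    rw [pow_succ, h]
    push_cast
    linear_combination (q / 2 : ℝ) * h5

/-- There are no positive integers `n1`, `n2`, `n3` and `a` with
`α^{n1} + α^{n2} + α^{n3} = 2^a·√5`, where `α = (1+√5)/2`. -/
theorem no_sum_of_three_powers_of_alpha_eq_power_of_two_mul_sqrt_five :
    ¬ ∃ (n1 n2 n3 a : ℕ), 0 < n1 ∧ 0 < n2 ∧ 0 < n3 ∧ 0 < a ∧
      ((1 + Real.sqrt 5) / 2) ^ n1 + ((1 + Real.sqrt 5) / 2) ^ n2 +
        ((1 + Real.sqrt 5) / 2) ^ n3 = (2 : ℝ) ^ a * Real.sqrt 5 := by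
  rintro ⟨n1, n2, n3, a, -, -, -, -, h⟩
  obtain ⟨p1, q1, hp1, -, h1⟩ := alpha_pow_form n1
  obtain ⟨p2, q2, hp2, -, h2⟩ := alpha_pow_form n2
  obtain ⟨p3, q3, hp3, -, h3⟩ := alpha_pow_form n3
  rw [h1, h2, h3] at h
  have hirr : Irrational (Real.sqrt 5) := by
    have := Nat.Prime.irrational_sqrt (p := 5) (by norm_num)
    simpa using this
  have key : ((p1 + p2 + p3 : ℚ) : ℝ) = ((2 ^ a - q1 - q2 - q3 : ℚ) : ℝ) * Real.sqrt 5 := by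
    push_cast
    linear_combination h
  have hP : 0 < p1 + p2 + p3 := by positivity
  by_cases hQ : (2 ^ a - q1 - q2 - q3 : ℚ) = 0
  · rw [hQ, Rat.cast_zero, zero_mul] at key
    have : p1 + p2 + p3 = 0 := by exact_mod_cast key
    linarith
  · exact (hirr.ratCast_mul hQ) ⟨_, key⟩
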